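/- arXiv:1507.06099 — 3 statements merged into one kernel-verified Lean document; each statement's English description precedes it below -/
import Mathlib

section
/- (Hardy–Littlewood, revisited) Let p, q ∈ [2, ∞) be real numbers with 1/p + 1/q < 1, and set λ = pq/(pq − p − q). Then there exists a constant C ≥ 1 such that for every positive integer n and every bilinear form A : ℓ_p^n × ℓ_q^n → 𝕂 (𝕂 = ℝ or ℂ), one has (∑_{k=1}^n (∑_{j=1}^n |A(e_j, e_k)|²)^{λ/2})^{1/λ} ≤ C‖A‖. -/
open scoped BigOperators

/-- The `ℓ_p` norm of a vector in `𝕂^n`: `(∑ i, ‖x i‖^p)^(1/p)`. -/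
noncomputable def lpNorm (𝕂 : Type*) [RCLike 𝕂] (p : ℝ) {n : ℕ} (x : Fin n → 𝕂) : ℝ :=
  (∑ i, ‖x i‖ ^ p) ^ (1 / p)

/-- The sup norm of a bilinear form on `ℓ_p^n × ℓ_q^n`. -/
noncomputable def bilinNorm (𝕂 : Type*) [RCLike 𝕂] (p q : ℝ) {n : ℕ}
    (A : (Fin n → 𝕂) →ₗ[𝕂] (Fin n → 𝕂) →ₗ[𝕂] 𝕂) : ℝ :=
  sSup {t : ℝ | ∃ x y : Fin n → 𝕂, lpNorm 𝕂 p x ≤ 1 ∧ lpNorm 𝕂 q y ≤ 1 ∧ t = ‖A x y‖}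

section Khinchin

open Finset

variable {𝕂 : Type*} [RCLike 𝕂]

/-- The sign `±1` attached to a Boolean. -/
def boolSign (𝕂 : Type*) [RCLike 𝕂] (b : Bool) : 𝕂 := if b then 1 else -1

lemma norm_boolSign (b : Bool) : ‖boolSign 𝕂 b‖ = 1 := by
  cases b <;> simp [boolSign]

lemma sum_signs_succ {n : ℕ} (f : (Fin (n + 1) → Bool) → ℝ) :
    ∑ ε, f ε = ∑ ε : Fin n → Bool, (f (Fin.cons true ε) + f (Fin.cons false ε)) := by
  rw [← (Fin.consEquiv fun _ : Fin (n + 1) => Bool).sum_comp, Fintype.sum_prod_type]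
  simp [Fin.consEquiv, sum_add_distrib]

lemma sum_signs_norm_sq {n : ℕ} (c : Fin n → 𝕂) :
    ∑ ε : Fin n → Bool, ‖∑ i, boolSign 𝕂 (ε i) * c i‖ ^ 2 = 2 ^ n * ∑ i, ‖c i‖ ^ 2 := by
  induction n with
  | zero => simp
  | succ n ih =>
    have key (a b : 𝕂) : ‖a + b‖ ^ 2 + ‖-a + b‖ ^ 2 = 2 * ‖b‖ ^ 2 + 2 * ‖a‖ ^ 2 := by
      have h := parallelogram_law_with_norm 𝕂 b a
      rw [show -a + b = b - a by ring, add_comm a b]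
      linarith
    rw [sum_signs_succ]
    simp only [Fin.sum_univ_succ, Fin.cons_zero, Fin.cons_succ, boolSign, if_true,
      Bool.false_eq_true, if_false, one_mul, neg_one_mul, key]
    simp only [boolSign] at ih
    rw [sum_add_distrib, ← mul_sum, ih]
    simp
    ring

lemma norm_add_pow_four_add_norm_sub_pow_four_le (a b : 𝕂) :
    ‖a + b‖ ^ 4 + ‖-a + b‖ ^ 4 ≤ 2 * ‖b‖ ^ 4 + 12 * ‖a‖ ^ 2 * ‖b‖ ^ 2 + 2 * ‖a‖ ^ 4 := by
  have h := parallelogram_law_with_norm 𝕂 b a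
  rw [show -a + b = b - a by ring, add_comm a b]
  have h1 : |‖b + a‖ ^ 2 - ‖b - a‖ ^ 2| ≤ 4 * (‖a‖ * ‖b‖) := by
    have e1 := norm_add_le b a
    have e2 := norm_sub_le b a
    have s1 : ‖b + a‖ ^ 2 ≤ (‖b‖ + ‖a‖) ^ 2 := by gcongr
    have s2 : ‖b - a‖ ^ 2 ≤ (‖b‖ + ‖a‖) ^ 2 := by gcongr
    rw [abs_le]
    constructor <;> nlinarith
  have h2 := sq_le_sq' (abs_le.1 h1).1 (abs_le.1 h1).2
  have h3 : (‖b + a‖ ^ 2 + ‖b - a‖ ^ 2) ^ 2 = (2 * (‖b‖ ^ 2 + ‖a‖ ^ 2)) ^ 2 := by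
    congr 1
  nlinarith

lemma sum_signs_norm_pow_four_le {n : ℕ} (c : Fin n → 𝕂) :
    ∑ ε : Fin n → Bool, ‖∑ i, boolSign 𝕂 (ε i) * c i‖ ^ 4 ≤
      2 ^ n * (3 * (∑ i, ‖c i‖ ^ 2) ^ 2) := by
  induction n with
  | zero => simp
  | succ n ih =>
    have h2 := sum_signs_norm_sq fun i : Fin n => c i.succ
    have h4 := ih fun i : Fin n => c i.succ
    rw [sum_signs_succ]
    simp only [Fin.sum_univ_succ, Fin.cons_zero, Fin.cons_succ, boolSign, if_true,
      Bool.false_eq_true, if_false, one_mul, neg_one_mul]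
    simp only [boolSign] at h2 h4
    refine (sum_le_sum fun ε _ => norm_add_pow_four_add_norm_sub_pow_four_le _ _).trans ?_
    rw [sum_add_distrib, sum_add_distrib, ← mul_sum, ← mul_sum, h2]
    set S := ∑ i : Fin n, ‖c i.succ‖ ^ 2
    simp only [sum_const, card_univ, Fintype.card_fun, Fintype.card_bool, Fintype.card_fin,
      nsmul_eq_mul]
    push_cast
    have : 0 ≤ (2 : ℝ) ^ n * ‖c 0‖ ^ 4 := by positivity
    rw [pow_succ (2 : ℝ) n]
    nlinarith

/-- **Khinchin inequality** between the first and second moments. -/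
lemma sqrt_sum_sq_le_sum_signs {n : ℕ} (c : Fin n → 𝕂) :
    2 ^ n * √(∑ i, ‖c i‖ ^ 2) ≤ 2 * ∑ ε : Fin n → Bool, ‖∑ i, boolSign 𝕂 (ε i) * c i‖ := by
  set σ := √(∑ i, ‖c i‖ ^ 2) with hσ
  have hσ2 : ∑ i, ‖c i‖ ^ 2 = σ ^ 2 := (Real.sq_sqrt (by positivity)).symm
  rcases (Real.sqrt_nonneg _ : 0 ≤ σ).eq_or_lt with h0 | h0
  · rw [hσ, ← h0, mul_zero]; positivity
  have pt (t : ℝ) (ht : 0 ≤ t) : 12 * σ ^ 2 * t ^ 2 - t ^ 4 ≤ 16 * σ ^ 3 * t := by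
    nlinarith [mul_nonneg (mul_nonneg ht (sq_nonneg (t - 2 * σ)))
      (by positivity : 0 ≤ t + 4 * σ)]
  have hs := sum_le_sum fun (ε : Fin n → Bool) (_ : ε ∈ univ) =>
    pt ‖∑ i, boolSign 𝕂 (ε i) * c i‖ (norm_nonneg _)
  rw [sum_sub_distrib, ← mul_sum, ← mul_sum, sum_signs_norm_sq] at hs
  have h4 := sum_signs_norm_pow_four_le c
  rw [hσ2] at hs h4
  set E := ∑ ε : Fin n → Bool, ‖∑ i, boolSign 𝕂 (ε i) * c i‖
  have h5 : σ ^ 3 * (9 * (2 ^ n * σ)) ≤ σ ^ 3 * (16 * E) := by nlinarith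
  have h6 := le_of_mul_le_mul_left h5 (by positivity)
  have : 0 ≤ 2 ^ n * σ := by positivity
  linarith

end Khinchin

section LpNorm

open Finset

variable {𝕂 : Type*} [RCLike 𝕂] {n : ℕ}

lemma lpNorm_nonneg (p : ℝ) (x : Fin n → 𝕂) : 0 ≤ lpNorm 𝕂 p x := by
  unfold lpNorm; positivity

lemma norm_le_lpNorm {p : ℝ} (hp : 0 < p) (x : Fin n → 𝕂) (i : Fin n) :
    ‖x i‖ ≤ lpNorm 𝕂 p x := by
  have h : ‖x i‖ ^ p ≤ ∑ i, ‖x i‖ ^ p :=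
    single_le_sum (f := fun i => ‖x i‖ ^ p) (fun _ _ => by positivity) (mem_univ i)
  calc ‖x i‖ = (‖x i‖ ^ p) ^ (1 / p) := by
        rw [← Real.rpow_mul (norm_nonneg _), mul_one_div_cancel hp.ne', Real.rpow_one]
    _ ≤ _ := Real.rpow_le_rpow (by positivity) h (by positivity)

lemma lpNorm_smul {p : ℝ} (hp : 0 < p) (c : 𝕂) (x : Fin n → 𝕂) :
    lpNorm 𝕂 p (c • x) = ‖c‖ * lpNorm 𝕂 p x := by
  simp only [lpNorm, Pi.smul_apply, norm_smul]
  simp_rw [Real.mul_rpow (norm_nonneg _) (norm_nonneg _)]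
  rw [← mul_sum, Real.mul_rpow (by positivity) (by positivity),
    ← Real.rpow_mul (norm_nonneg _), mul_one_div_cancel hp.ne', Real.rpow_one]

lemma apply_eq_sum_mul_apply_single (f : (Fin n → 𝕂) →ₗ[𝕂] 𝕂) (y : Fin n → 𝕂) :
    f y = ∑ k, y k * f (Pi.single k 1) := by
  rw [f.pi_apply_eq_sum_univ y]
  refine sum_congr rfl fun k _ => ?_
  rw [smul_eq_mul]
  congr 2
  ext i
  simp [Pi.single_apply, eq_comm]

lemma bddAbove_bilin {p q : ℝ} (hp : 0 < p) (hq : 0 < q)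
    (A : (Fin n → 𝕂) →ₗ[𝕂] (Fin n → 𝕂) →ₗ[𝕂] 𝕂) :
    BddAbove {t : ℝ | ∃ x y : Fin n → 𝕂,
      lpNorm 𝕂 p x ≤ 1 ∧ lpNorm 𝕂 q y ≤ 1 ∧ t = ‖A x y‖} := by
  refine ⟨∑ k, ∑ j, ‖A (Pi.single j 1) (Pi.single k 1)‖, ?_⟩
  rintro _ ⟨x, y, hx, hy, rfl⟩
  rw [apply_eq_sum_mul_apply_single]
  refine norm_sum_le_of_le _ fun k _ => ?_
  rw [norm_mul, ← A.flip_apply, apply_eq_sum_mul_apply_single]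
  refine (mul_le_of_le_one_left (norm_nonneg _) ((norm_le_lpNorm hq y k).trans hy)).trans ?_
  refine norm_sum_le_of_le _ fun j _ => ?_
  rw [norm_mul, A.flip_apply]
  exact mul_le_of_le_one_left (norm_nonneg _) ((norm_le_lpNorm hp x j).trans hx)

lemma bilinNorm_nonneg (p q : ℝ) (A : (Fin n → 𝕂) →ₗ[𝕂] (Fin n → 𝕂) →ₗ[𝕂] 𝕂) :
    0 ≤ bilinNorm 𝕂 p q A := by
  refine Real.sSup_nonneg ?_
  rintro _ ⟨x, y, -, -, rfl⟩
  exact norm_nonneg _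

lemma norm_apply_le_bilinNorm {p q : ℝ} (hp : 0 < p) (hq : 0 < q)
    (A : (Fin n → 𝕂) →ₗ[𝕂] (Fin n → 𝕂) →ₗ[𝕂] 𝕂) (x y : Fin n → 𝕂) :
    ‖A x y‖ ≤ bilinNorm 𝕂 p q A * lpNorm 𝕂 p x * lpNorm 𝕂 q y := by
  have zero_of {p : ℝ} (hp : 0 < p) (x : Fin n → 𝕂) (h : 0 = lpNorm 𝕂 p x) : x = 0 :=
    funext fun i => norm_le_zero_iff.1 (h ▸ norm_le_lpNorm hp x i)
  rcases (lpNorm_nonneg p x).eq_or_lt with hx | hx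
  · simp [zero_of hp x hx, lpNorm_nonneg, bilinNorm_nonneg, mul_nonneg]
  rcases (lpNorm_nonneg q y).eq_or_lt with hy | hy
  · simp [zero_of hq y hy, lpNorm_nonneg, bilinNorm_nonneg, mul_nonneg]
  have h : ‖A (((lpNorm 𝕂 p x)⁻¹ : ℝ) • x) (((lpNorm 𝕂 q y)⁻¹ : ℝ) • y)‖ ≤
      bilinNorm 𝕂 p q A := by
    refine le_csSup (bddAbove_bilin hp hq A) ⟨_, _, ?_, ?_, rfl⟩
    · rw [RCLike.real_smul_eq_coe_smul (K := 𝕂), lpNorm_smul hp, RCLike.norm_ofReal, abs_inv,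
        abs_of_pos hx, inv_mul_cancel₀ hx.ne']
    · rw [RCLike.real_smul_eq_coe_smul (K := 𝕂), lpNorm_smul hq, RCLike.norm_ofReal, abs_inv,
        abs_of_pos hy, inv_mul_cancel₀ hy.ne']
  rw [RCLike.real_smul_eq_coe_smul (K := 𝕂), RCLike.real_smul_eq_coe_smul (K := 𝕂)] at h
  simp only [map_smul, LinearMap.smul_apply, norm_smul, RCLike.norm_ofReal, abs_inv,
    abs_of_pos hx, abs_of_pos hy] at h
  field_simp at h
  linarith

lemma sum_mul_norm_apply_single_le {q N : ℝ} {f : (Fin n → 𝕂) →ₗ[𝕂] 𝕂}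
    (hf : ∀ y, ‖f y‖ ≤ N * lpNorm 𝕂 q y) {v : Fin n → ℝ} (hv : ∀ k, 0 ≤ v k) :
    ∑ k, v k * ‖f (Pi.single k 1)‖ ≤ N * (∑ k, v k ^ q) ^ (1 / q) := by
  choose c hc hfc using fun k => RCLike.exists_norm_eq_mul_self (f (Pi.single k 1))
  have hn (k) : ‖(v k : 𝕂) * c k‖ = v k := by
    rw [norm_mul, hc, mul_one, RCLike.norm_ofReal, abs_of_nonneg (hv k)]
  have h := hf fun k => (v k : 𝕂) * c k
  simp only [lpNorm, hn] at h
  refine le_trans (le_of_eq ?_) h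
  rw [apply_eq_sum_mul_apply_single]
  simp_rw [mul_assoc, ← hfc]
  rw [← abs_of_nonneg (sum_nonneg fun k _ => mul_nonneg (hv k) (norm_nonneg _)),
    ← RCLike.norm_ofReal (K := 𝕂)]
  push_cast
  rfl

/-- Weighted mixed `(1, 2)`-norm estimate for the coefficients of a bounded bilinear form. -/
lemma sum_mul_sqrt_sum_sq_le {p q N : ℝ} {A : (Fin n → 𝕂) →ₗ[𝕂] (Fin n → 𝕂) →ₗ[𝕂] 𝕂}
    (hA : ∀ x y, ‖A x y‖ ≤ N * lpNorm 𝕂 p x * lpNorm 𝕂 q y)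
    {u v : Fin n → ℝ} (hu : ∀ j, 0 ≤ u j) (hv : ∀ k, 0 ≤ v k) :
    ∑ k, v k * √(∑ j, (u j * ‖A (Pi.single j 1) (Pi.single k 1)‖) ^ 2) ≤
      2 * N * (∑ j, u j ^ p) ^ (1 / p) * (∑ k, v k ^ q) ^ (1 / q) := by
  have hε (ε : Fin n → Bool) :
      ∑ k, v k * ‖∑ j, boolSign 𝕂 (ε j) * ((u j : 𝕂) * A (Pi.single j 1) (Pi.single k 1))‖ ≤
        N * (∑ j, u j ^ p) ^ (1 / p) * (∑ k, v k ^ q) ^ (1 / q) := by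
    set x : Fin n → 𝕂 := fun j => boolSign 𝕂 (ε j) * u j with hx
    have hn : lpNorm 𝕂 p x = (∑ j, u j ^ p) ^ (1 / p) := by
      simp [lpNorm, hx, norm_boolSign, abs_of_nonneg (hu _)]
    have h := sum_mul_norm_apply_single_le (hA x) hv
    rw [hn] at h
    refine le_trans (le_of_eq (sum_congr rfl fun k _ => ?_)) h
    rw [← A.flip_apply, apply_eq_sum_mul_apply_single (A.flip _)]
    simp [hx, mul_assoc]
  have hk (k : Fin n) := sqrt_sum_sq_le_sum_signs
    fun j => (u j : 𝕂) * A (Pi.single j 1) (Pi.single k 1)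
  simp only [norm_mul, RCLike.norm_ofReal, abs_of_nonneg (hu _)] at hk
  have h1 := sum_le_sum fun k (_ : k ∈ univ) => mul_le_mul_of_nonneg_left (hk k) (hv k)
  have h2 := sum_le_sum fun ε (_ : ε ∈ univ) => hε ε
  rw [sum_comm, sum_const, card_univ, Fintype.card_fun, Fintype.card_bool, Fintype.card_fin,
    nsmul_eq_mul] at h2
  push_cast at h2
  simp only [← mul_sum, mul_left_comm (v _)] at h1 h2
  refine le_of_mul_le_mul_left (a := (2 : ℝ) ^ n) ?_ (by positivity)
  linarith

end LpNorm

section MixedNorm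

open Finset

variable {ι κ : Type*} [Fintype ι] [Fintype κ]

/-- Hölder interpolation of the sum `∑ b j ^ 2` between two weighted sums. -/
lemma sum_sq_le_interpolation {r : ℝ} (hr : 1 < r) (hr2 : r ≤ 2) {b s : ι → ℝ}
    (hs : ∀ j, 0 ≤ s j) (hbs : ∀ j, s j = 0 → b j = 0) :
    ∑ j, b j ^ 2 ≤ (∑ j, (s j ^ (r - 1) * b j) ^ 2) ^ ((2 - r) / r) *
      (∑ j, b j ^ 2 * s j ^ (r - 2)) ^ (2 * (r - 1) / r) := by
  have h := Real.inner_le_weight_mul_Lp_of_nonneg univ (p := r / (2 * (r - 1)))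
    (by rw [le_div_iff₀ (by linarith)]; linarith) (fun j => (s j ^ (r - 1) * b j) ^ 2)
    (fun j => s j ^ (2 - 2 * r)) (fun j => by positivity)
    (fun j => Real.rpow_nonneg (hs j) _)
  have e1 : 1 - (r / (2 * (r - 1)))⁻¹ = (2 - r) / r := by
    have : r - 1 ≠ 0 := by linarith
    field_simp
    ring
  rw [e1, inv_div] at h
  refine (le_of_eq ?_).trans (h.trans_eq ?_)
  · refine sum_congr rfl fun j _ => ?_
    rcases (hs j).eq_or_lt with h0 | h0
    · simp [hbs j h0.symm]
    · rw [mul_pow, ← Real.rpow_natCast (s j ^ (r - 1)), ← Real.rpow_mul h0.le,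
        mul_right_comm, ← Real.rpow_add h0]
      ring_nf
      simp
  · congr 2
    refine sum_congr rfl fun j _ => ?_
    rcases (hs j).eq_or_lt with h0 | h0
    · simp [hbs j h0.symm]
    · rw [mul_pow, ← Real.rpow_natCast (s j ^ (r - 1)), ← Real.rpow_mul h0.le,
        ← Real.rpow_mul h0.le, mul_right_comm, ← Real.rpow_add h0, mul_comm]
      congr 2
      have : r - 1 ≠ 0 := by linarith
      push_cast
      field_simp
      ring

lemma le_rpow_of_le_mul_rpow {p r D S : ℝ} (h : p.HolderConjugate r) (hD : 0 ≤ D) (hS : 0 ≤ S)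
    (hSD : S ≤ D * S ^ (1 / p)) : S ≤ D ^ r := by
  rcases hS.eq_or_lt with h0 | h0
  · rw [← h0]; positivity
  have e : S ^ (1 / r) * S ^ (1 / p) = S := by
    rw [← Real.rpow_add h0, add_comm, one_div, one_div, h.inv_add_inv_eq_one, Real.rpow_one]
  have h1 : S ^ (1 / r) ≤ D := by
    refine le_of_mul_le_mul_right ?_ (Real.rpow_pos_of_pos h0 (1 / p))
    rwa [e]
  have h2 := Real.rpow_le_rpow (by positivity) h1 h.symm.nonneg
  rwa [← Real.rpow_mul hS, one_div_mul_cancel h.symm.ne_zero, Real.rpow_one] at h2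

lemma sum_rpow_sum_sq_le {p r D : ℝ} (h : p.HolderConjugate r) (hr2 : r ≤ 2) (hD : 0 ≤ D)
    (b : ι → κ → ℝ)
    (h₁ : ∀ w : ι → ℝ, (∀ j, 0 ≤ w j) →
      ∑ j, w j * √(∑ k, b j k ^ 2) ≤ D * (∑ j, w j ^ p) ^ (1 / p))
    (h₂ : ∀ w : ι → ℝ, (∀ j, 0 ≤ w j) →
      ∑ k, √(∑ j, (w j * b j k) ^ 2) ≤ D * (∑ j, w j ^ p) ^ (1 / p)) :
    ∑ k, (∑ j, b j k ^ 2) ^ (r / 2) ≤ D ^ r := by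
  have hr : 1 < r := h.symm.lt
  have hr0 : 0 < r := by linarith
  set s : ι → ℝ := fun j => √(∑ k, b j k ^ 2) with hs_def
  have hs (j) : 0 ≤ s j := Real.sqrt_nonneg _
  have hs2 (j) : ∑ k, b j k ^ 2 = s j ^ 2 := (Real.sq_sqrt (by positivity)).symm
  have hbs (j k) (h0 : s j = 0) : b j k = 0 := by
    have h' := hs2 j
    rw [h0, zero_pow two_ne_zero, sum_eq_zero_iff_of_nonneg fun _ _ => by positivity] at h'
    simpa using h' k (mem_univ k)
  have hw (j) : 0 ≤ s j ^ (r - 1) := Real.rpow_nonneg (hs j) _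
  have hwp (j) : (s j ^ (r - 1)) ^ p = s j ^ r := by
    rw [← Real.rpow_mul (hs j), h.symm.sub_one_mul_conj]
  have hws (j) : s j ^ (r - 1) * s j = s j ^ r := by
    rw [← Real.rpow_add_one' (hs j) (by linarith), sub_add_cancel]
  have k₁ := h₁ _ hw
  have k₂ := h₂ _ hw
  simp only [hwp] at k₁ k₂
  have k₁' : ∑ j, s j ^ r ≤ D * (∑ j, s j ^ r) ^ (1 / p) :=
    (sum_congr rfl fun j _ => (hws j).symm).trans_le k₁
  set S := ∑ j, s j ^ r with hS_def
  have hS : 0 ≤ S := sum_nonneg fun j _ => Real.rpow_nonneg (hs j) _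
  have hSD : S ≤ D ^ r := le_rpow_of_le_mul_rpow h hD hS k₁'
  have hPD : D * S ^ (1 / p) ≤ D ^ r := by
    calc D * S ^ (1 / p) ≤ D * (D ^ r) ^ (1 / p) := by have := h.nonneg; gcongr
      _ = D ^ r := by
        have : r * (1 / p) = r - 1 := by
          rw [mul_one_div, div_eq_iff h.ne_zero, h.symm.sub_one_mul_conj]
        rw [← Real.rpow_mul hD, this, mul_comm, ← Real.rpow_add_one' hD (by linarith),
          sub_add_cancel]
  set Q : κ → ℝ := fun k => ∑ j, b j k ^ 2 * s j ^ (r - 2) with hQ_def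
  have hQ (k) : 0 ≤ Q k :=
    sum_nonneg fun j _ => mul_nonneg (sq_nonneg _) (Real.rpow_nonneg (hs j) _)
  have hQS : ∑ k, Q k = S := by
    rw [hQ_def, sum_comm]
    refine sum_congr rfl fun j _ => ?_
    rw [← sum_mul, hs2, ← Real.rpow_natCast, ← Real.rpow_add' (hs j)]
    · congr 1; push_cast; ring
    · push_cast; linarith
  have hk (k) : (∑ j, b j k ^ 2) ^ (r / 2) ≤
      (2 - r) * √(∑ j, (s j ^ (r - 1) * b j k) ^ 2) + (r - 1) * Q k := by
    have hP : 0 ≤ ∑ j, (s j ^ (r - 1) * b j k) ^ 2 := by positivity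
    refine (Real.rpow_le_rpow (by positivity)
      (sum_sq_le_interpolation hr hr2 hs fun j => hbs j k) (by positivity)).trans ?_
    rw [Real.mul_rpow (by positivity) (Real.rpow_nonneg (hQ k) _), ← Real.rpow_mul hP,
      ← Real.rpow_mul (hQ k)]
    refine le_trans (le_of_eq ?_) (Real.geom_mean_le_arith_mean2_weighted (by linarith)
      (by linarith) (Real.sqrt_nonneg _) (hQ k) (by ring))
    rw [Real.sqrt_eq_rpow, ← Real.rpow_mul hP]
    congr 2 <;> field_simp
  calc _ ≤ ∑ k, ((2 - r) * √(∑ j, (s j ^ (r - 1) * b j k) ^ 2) + (r - 1) * Q k) :=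
        sum_le_sum fun k _ => hk k
    _ = (2 - r) * ∑ k, √(∑ j, (s j ^ (r - 1) * b j k) ^ 2) + (r - 1) * S := by
        rw [sum_add_distrib, ← mul_sum, ← mul_sum, hQS]
    _ ≤ (2 - r) * D ^ r + (r - 1) * D ^ r := by
        have h1 := k₂.trans hPD
        have : 0 ≤ 2 - r := by linarith
        have : 0 ≤ r - 1 := by linarith
        gcongr
    _ = D ^ r := by ring

lemma rpow_sum_rpow_sum_sq_le {p q r lam M : ℝ} (h : p.HolderConjugate r) (hr2 : r ≤ 2)
    (hq : 0 < q) (hlam : 0 < lam) (hrq : 1 / lam + 1 / q = 1 / r) (hM : 0 ≤ M)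
    (a : ι → κ → ℝ)
    (h₁ : ∀ (w : ι → ℝ) (y : κ → ℝ), (∀ j, 0 ≤ w j) → (∀ k, 0 ≤ y k) →
      ∑ j, w j * √(∑ k, (y k * a j k) ^ 2) ≤
        M * (∑ k, y k ^ q) ^ (1 / q) * (∑ j, w j ^ p) ^ (1 / p))
    (h₂ : ∀ (w : ι → ℝ) (y : κ → ℝ), (∀ j, 0 ≤ w j) → (∀ k, 0 ≤ y k) →
      ∑ k, y k * √(∑ j, (w j * a j k) ^ 2) ≤
        M * (∑ k, y k ^ q) ^ (1 / q) * (∑ j, w j ^ p) ^ (1 / p)) :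
    (∑ k, (∑ j, a j k ^ 2) ^ (lam / 2)) ^ (1 / lam) ≤ M := by
  have hr0 : 0 < r := h.symm.pos
  set ρ : κ → ℝ := fun k => √(∑ j, a j k ^ 2) with hρ_def
  have hρ (k) : 0 ≤ ρ k := Real.sqrt_nonneg _
  have hρ2 (k) : ∑ j, a j k ^ 2 = ρ k ^ 2 := (Real.sq_sqrt (by positivity)).symm
  have sq_rpow {x : ℝ} (hx : 0 ≤ x) (t : ℝ) : (x ^ 2) ^ (t / 2) = x ^ t := by
    rw [← Real.rpow_natCast, ← Real.rpow_mul hx]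
    congr 1; push_cast; ring
  simp only [hρ2, sq_rpow (hρ _)]
  have hy (k) : 0 ≤ ρ k ^ (lam / q) := Real.rpow_nonneg (hρ k) _
  have hyq (k) : (ρ k ^ (lam / q)) ^ q = ρ k ^ lam := by
    rw [← Real.rpow_mul (hρ k), div_mul_cancel₀ _ hq.ne']
  set R := ∑ k, ρ k ^ lam with hR_def
  have hR : 0 ≤ R := sum_nonneg fun k _ => Real.rpow_nonneg (hρ k) _
  have key := sum_rpow_sum_sq_le h hr2 (D := M * R ^ (1 / q)) (by positivity)
    (fun j k => ρ k ^ (lam / q) * a j k)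
    (fun w hw => by simpa only [hyq] using h₁ w _ hw hy)
    (fun w hw => by
      refine le_trans (le_of_eq (sum_congr rfl fun k _ => ?_))
        (by simpa only [hyq] using h₂ w _ hw hy)
      simp_rw [mul_left_comm (w _), mul_pow (ρ k ^ (lam / q))]
      rw [← mul_sum, Real.sqrt_mul (sq_nonneg _), Real.sqrt_sq (hy k)])
  have hterm (k) : (∑ j, (ρ k ^ (lam / q) * a j k) ^ 2) ^ (r / 2) = ρ k ^ lam := by
    simp_rw [mul_pow (ρ k ^ (lam / q))]
    rw [← mul_sum, hρ2, ← mul_pow, sq_rpow (mul_nonneg (hy k) (hρ k)),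
      ← Real.rpow_add_one' (hρ k) (by positivity), ← Real.rpow_mul (hρ k)]
    congr 1
    field_simp at hrq ⊢
    linarith
  simp only [hterm, ← hR_def] at key
  rcases hR.eq_or_lt with h0 | h0
  · rw [← h0, Real.zero_rpow (by positivity)]; exact hM
  have k2 := Real.rpow_le_rpow hR key (by positivity : 0 ≤ 1 / r)
  rw [← Real.rpow_mul (by positivity), mul_one_div_cancel hr0.ne', Real.rpow_one, ← hrq,
    Real.rpow_add h0] at k2
  exact le_of_mul_le_mul_right k2 (by positivity)

end MixedNorm

theorem hardy_littlewood_revisited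
    (𝕂 : Type*) [RCLike 𝕂] (p q : ℝ) (hp : 2 ≤ p) (hq : 2 ≤ q)
    (hpq : 1 / p + 1 / q < 1) (lam : ℝ) (hlam : lam = p * q / (p * q - p - q)) :
    ∃ C : ℝ, 1 ≤ C ∧ ∀ n : ℕ, 0 < n →
      ∀ A : (Fin n → 𝕂) →ₗ[𝕂] (Fin n → 𝕂) →ₗ[𝕂] 𝕂,
        (∑ k : Fin n, (∑ j : Fin n,
            ‖A (Pi.single j (1 : 𝕂)) (Pi.single k (1 : 𝕂))‖ ^ (2 : ℝ)) ^ (lam / 2)) ^ (1 / lam)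
          ≤ C * bilinNorm 𝕂 p q A := by
  have hp0 : 0 < p := by linarith
  have hq0 : 0 < q := by linarith
  have hd : 0 < p * q - p - q := by
    rw [div_add_div _ _ hp0.ne' hq0.ne', div_lt_one (by positivity)] at hpq
    linarith
  have hlam0 : 0 < lam := hlam ▸ by positivity
  have hconj : p.HolderConjugate (p / (p - 1)) := .conjExponent (by linarith)
  have hr2 : p / (p - 1) ≤ 2 := by rw [div_le_iff₀ (by linarith)]; linarith
  have hrq : 1 / lam + 1 / q = 1 / (p / (p - 1)) := by
    rw [hlam]
    field_simp
    ring
  refine ⟨2, one_le_two, fun n _ A => ?_⟩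
  simp only [Real.rpow_two]
  have hA := norm_apply_le_bilinNorm hp0 hq0 A
  have hN := bilinNorm_nonneg p q A
  refine rpow_sum_rpow_sum_sq_le hconj hr2 hq0 hlam0 hrq (by positivity)
    (fun j k => ‖A (Pi.single j 1) (Pi.single k 1)‖) (fun w y hw hy => ?_) fun w y hw hy => ?_
  · exact sum_mul_sqrt_sum_sq_le (A := A.flip) (N := bilinNorm 𝕂 p q A)
      (fun x y => (hA y x).trans_eq (mul_right_comm _ _ _)) hy hw
  · exact (sum_mul_sqrt_sum_sq_le hA hw hy).trans_eq (mul_right_comm _ _ _)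
end

section
/- Let p, q ∈ [2, ∞) be real numbers with 1/p + 1/q < 1, and set λ = pq/(pq − p − q). If s > 0 and C > 0 are such that for every positive integer n and every bilinear form A : ℓ_p^n × ℓ_q^n → 𝕂 (𝕂 = ℝ or ℂ) one has (∑_{k=1}^n (∑_{j=1}^n |A(e_j, e_k)|²)^{s/2})^{1/s} ≤ C‖A‖, then s ≥ λ. -/
open scoped BigOperators

theorem sum_rpow_le_one_of_lpNorm_le_one {𝕂 : Type*} [RCLike 𝕂] {p : ℝ} (hp : 0 < p) {n : ℕ}
    {x : Fin n → 𝕂} (hx : lpNorm 𝕂 p x ≤ 1) : ∑ i, ‖x i‖ ^ p ≤ 1 := by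
  by_contra! hlt
  exact absurd hx (not_le.2 (Real.one_lt_rpow hlt (by positivity)))

/-- Hölder's inequality for the exponents `p`, `q` and `1 / r`, the third factor being constant. -/
theorem sum_mul_norm_le_rpow {𝕂 : Type*} [RCLike 𝕂] {p q r : ℝ} (hp : 0 < p) (hq : 0 < q)
    (hr : 0 ≤ r) (hpqr : 1 / p + 1 / q + r = 1) {n : ℕ} (hn : 0 < n) {x y : Fin n → 𝕂}
    (hx : lpNorm 𝕂 p x ≤ 1) (hy : lpNorm 𝕂 q y ≤ 1) :
    ∑ i, ‖x i‖ * ‖y i‖ ≤ (n : ℝ) ^ r := by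
  have hn' : (0 : ℝ) < n := by exact_mod_cast hn
  have young (i : Fin n) : ‖x i‖ * ‖y i‖ * ((n : ℝ) ^ r)⁻¹
      ≤ 1 / p * ‖x i‖ ^ p + 1 / q * ‖y i‖ ^ q + r * (n : ℝ)⁻¹ := by
    have := Real.geom_mean_le_arith_mean3_weighted (w₁ := 1 / p) (w₂ := 1 / q) (w₃ := r)
      (p₁ := ‖x i‖ ^ p) (p₂ := ‖y i‖ ^ q) (p₃ := (n : ℝ)⁻¹) (by positivity) (by positivity) hr
      (by positivity) (by positivity) (by positivity) hpqr
    rw [one_div, one_div, Real.rpow_rpow_inv (norm_nonneg _) hp.ne',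
      Real.rpow_rpow_inv (norm_nonneg _) hq.ne', Real.inv_rpow hn'.le] at this
    rwa [one_div, one_div]
  have hsum : (∑ i, ‖x i‖ * ‖y i‖) * ((n : ℝ) ^ r)⁻¹ ≤ 1 := calc
    _ ≤ ∑ i, (1 / p * ‖x i‖ ^ p + 1 / q * ‖y i‖ ^ q + r * (n : ℝ)⁻¹) := by
      rw [Finset.sum_mul]
      exact Finset.sum_le_sum fun i _ => young i
    _ = 1 / p * ∑ i, ‖x i‖ ^ p + 1 / q * ∑ i, ‖y i‖ ^ q + r := by
      simp only [Finset.sum_add_distrib, ← Finset.mul_sum, Finset.sum_const, Finset.card_univ,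
        Fintype.card_fin, nsmul_eq_mul]
      field_simp
    _ ≤ 1 / p * 1 + 1 / q * 1 + r := by
      gcongr
      · exact sum_rpow_le_one_of_lpNorm_le_one hp hx
      · exact sum_rpow_le_one_of_lpNorm_le_one hq hy
    _ = 1 := by rw [mul_one, mul_one, hpqr]
  rwa [← div_eq_mul_inv, div_le_one (by positivity)] at hsum

theorem bilinNorm_dotProductBilin_le {𝕂 : Type*} [RCLike 𝕂] {p q r : ℝ} (hp : 0 < p) (hq : 0 < q)
    (hr : 0 ≤ r) (hpqr : 1 / p + 1 / q + r = 1) {n : ℕ} (hn : 0 < n) :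
    bilinNorm 𝕂 p q (dotProductBilin 𝕂 𝕂 : (Fin n → 𝕂) →ₗ[𝕂] (Fin n → 𝕂) →ₗ[𝕂] 𝕂)
      ≤ (n : ℝ) ^ r := by
  refine Real.sSup_le ?_ (by positivity)
  rintro _ ⟨x, y, hx, hy, rfl⟩
  calc ‖x ⬝ᵥ y‖ ≤ ∑ i, ‖x i * y i‖ := norm_sum_le _ _
    _ = ∑ i, ‖x i‖ * ‖y i‖ := by simp only [norm_mul]
    _ ≤ (n : ℝ) ^ r := sum_mul_norm_le_rpow hp hq hr hpqr hn hx hy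

theorem le_of_forall_natCast_rpow_le {a b C : ℝ}
    (h : ∀ n : ℕ, 0 < n → (n : ℝ) ^ a ≤ C * (n : ℝ) ^ b) : a ≤ b := by
  by_contra! hlt
  have htop : Filter.Tendsto (fun n : ℕ => (n : ℝ) ^ (a - b)) Filter.atTop Filter.atTop :=
    (tendsto_rpow_atTop (sub_pos.2 hlt)).comp tendsto_natCast_atTop_atTop
  obtain ⟨n, hn, hn0⟩ := ((htop.eventually_gt_atTop C).and (Filter.eventually_gt_atTop 0)).exists
  have hn' : (0 : ℝ) < n := by exact_mod_cast hn0
  rw [Real.rpow_sub hn', lt_div_iff₀ (by positivity)] at hn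
  exact absurd (h n hn0) (not_le.2 hn)

theorem hardy_littlewood_revisited_outer_exponent_optimal
    (𝕂 : Type*) [RCLike 𝕂] (p q : ℝ) (hp : 2 ≤ p) (hq : 2 ≤ q)
    (hpq : 1 / p + 1 / q < 1) (lam : ℝ) (hlam : lam = p * q / (p * q - p - q))
    (s C : ℝ) (hs : 0 < s) (hC : 0 < C)
    (h : ∀ n : ℕ, 0 < n → ∀ A : (Fin n → 𝕂) →ₗ[𝕂] (Fin n → 𝕂) →ₗ[𝕂] 𝕂,
      (∑ k : Fin n, (∑ j : Fin n,
          ‖A (Pi.single j (1 : 𝕂)) (Pi.single k (1 : 𝕂))‖ ^ (2 : ℝ)) ^ (s / 2)) ^ (1 / s)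
        ≤ C * bilinNorm 𝕂 p q A) :
    lam ≤ s := by
  have hp0 : 0 < p := by linarith
  have hq0 : 0 < q := by linarith
  have hlam_inv : 1 / lam = 1 - 1 / p - 1 / q := by
    rw [hlam, one_div_div]
    field_simp
    ring
  have hlam0 : 0 < lam := one_div_pos.1 (by linarith)
  refine (one_div_le_one_div hs hlam0).1 (le_of_forall_natCast_rpow_le (C := C) fun n hn => ?_)
  have entry (j k : Fin n) :
      ‖(dotProductBilin 𝕂 𝕂 : (Fin n → 𝕂) →ₗ[𝕂] (Fin n → 𝕂) →ₗ[𝕂] 𝕂)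
        (Pi.single j (1 : 𝕂)) (Pi.single k (1 : 𝕂))‖ ^ (2 : ℝ) = if j = k then 1 else 0 := by
    by_cases hjk : j = k <;> simp [dotProductBilin, hjk]
  have hA := h n hn (dotProductBilin 𝕂 𝕂)
  simp only [entry, Finset.sum_ite_eq', Finset.mem_univ, if_true, Real.one_rpow,
    Finset.sum_const, Finset.card_univ, Fintype.card_fin, nsmul_eq_mul, mul_one] at hA
  exact hA.trans <| mul_le_mul_of_nonneg_left
    (bilinNorm_dotProductBilin_le hp0 hq0 (by positivity) (by linarith) hn) hC.le
end

section
/- Let p, q ∈ [2, ∞) be real numbers with 1/p + 1/q < 1, and set λ = pq/(pq − p − q). If r > 0 and C > 0 are such that for every positive integer n and every bilinear form A : ℓ_p^n × ℓ_q^n → 𝕂 (𝕂 = ℝ or ℂ) one has (∑_{k=1}^n (∑_{j=1}^n |A(e_j, e_k)|^r)^{λ/r})^{1/λ} ≤ C‖A‖, then r ≥ 2. -/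
open scoped BigOperators

open Matrix in
/-- Sylvester's construction of Hadamard matrices of order `2 ^ m`. -/
lemma exists_hadamard_two_pow (𝕂 : Type*) [RCLike 𝕂] (m : ℕ) :
    ∃ H : Matrix (Fin (2 ^ m)) (Fin (2 ^ m)) 𝕂,
      (∀ i j, ‖H i j‖ = 1) ∧ Hᴴ * H = ((2 ^ m : ℕ) : 𝕂) • 1 := by
  induction m with
  | zero =>
    have hsub : Subsingleton (Fin (2 ^ 0)) := inferInstanceAs (Subsingleton (Fin 1))
    refine ⟨1, fun i j => ?_, by simp⟩
    rw [Subsingleton.elim i j, Matrix.one_apply_eq, norm_one]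
  | succ m ih =>
    obtain ⟨H, hnorm, hH⟩ := ih
    let K : Matrix (Fin 2) (Fin 2) 𝕂 := !![1, 1; 1, -1]
    have hK : Kᴴ * K = (2 : 𝕂) • 1 := by
      ext i j
      fin_cases i <;> fin_cases j <;> norm_num [K, Matrix.mul_apply, Fin.sum_univ_two]
    have hKnorm : ∀ i j, ‖K i j‖ = 1 := by
      intro i j
      fin_cases i <;> fin_cases j <;> simp [K]
    let e : Fin (2 ^ m) × Fin 2 ≃ Fin (2 ^ (m + 1)) := finProdFinEquiv
    refine ⟨(kroneckerMap (· * ·) H K).submatrix e.symm e.symm, ?_, ?_⟩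
    · intro i j
      simp [hnorm, hKnorm]
    · rw [conjTranspose_submatrix, submatrix_mul_equiv, conjTranspose_kronecker,
        ← mul_kronecker_mul, hH, hK, smul_kronecker, kronecker_smul, one_kronecker_one,
        smul_smul]
      ext i j
      simp [Matrix.one_apply, pow_succ]

open Matrix in
lemma sum_norm_sq_mulVec_of_conjTranspose_mul_self {𝕂 : Type*} [RCLike 𝕂] {n : ℕ}
    {H : Matrix (Fin n) (Fin n) 𝕂} {c : ℝ} (hH : Hᴴ * H = (c : 𝕂) • 1) (x : Fin n → 𝕂) :
    ∑ k, ‖(H *ᵥ x) k‖ ^ 2 = c * ∑ j, ‖x j‖ ^ 2 := by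
  have hstar (v : Fin n → 𝕂) : star v ⬝ᵥ v = ((∑ k, ‖v k‖ ^ 2 : ℝ) : 𝕂) := by
    simp [dotProduct, RCLike.conj_mul]
  have key : star (H *ᵥ x) ⬝ᵥ (H *ᵥ x) = (c : 𝕂) * (star x ⬝ᵥ x) := by
    rw [star_mulVec, ← dotProduct_mulVec, mulVec_mulVec, hH, smul_mulVec, one_mulVec,
      dotProduct_smul, smul_eq_mul]
  rw [hstar, hstar] at key
  exact_mod_cast key

/-- The `ℓ_p` unit ball, `2 ≤ p`, lies in the `ℓ_2` ball of radius `n ^ (1 / 2 - 1 / p)`. -/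
lemma sum_norm_sq_le_of_lpNorm_le_one {𝕂 : Type*} [RCLike 𝕂] {p : ℝ} (hp : 2 ≤ p) {n : ℕ}
    {x : Fin n → 𝕂} (hx : lpNorm 𝕂 p x ≤ 1) :
    ∑ i, ‖x i‖ ^ 2 ≤ (n : ℝ) ^ (1 - 2 / p) := by
  have hp0 : 0 < p := by linarith
  have hsum : ∑ i, ‖x i‖ ^ p ≤ 1 := by
    by_contra! hlt
    exact hx.not_gt (Real.one_lt_rpow hlt (by positivity))
  have hpow : (∑ i, ‖x i‖ ^ 2) ^ (p / 2) ≤ (n : ℝ) ^ (p / 2 - 1) := by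
    have h := Real.rpow_sum_le_const_mul_sum_rpow (s := Finset.univ)
      (f := fun i => ‖x i‖ ^ 2) (p := p / 2) (by linarith)
    have hterm (i : Fin n) : (‖x i‖ ^ 2) ^ (p / 2) = ‖x i‖ ^ p := by
      rw [← Real.rpow_natCast, ← Real.rpow_mul (norm_nonneg _)]
      congr 1
      push_cast
      ring
    simp only [abs_pow, abs_norm, hterm, Finset.card_univ, Fintype.card_fin] at h
    exact h.trans (mul_le_of_le_one_right (by positivity) hsum)
  have h := Real.rpow_le_rpow (by positivity) hpow (show 0 ≤ 2 / p by positivity)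
  rw [← Real.rpow_mul (by positivity), ← Real.rpow_mul (by positivity)] at h
  convert h using 1
  · rw [show p / 2 * (2 / p) = 1 by field_simp, Real.rpow_one]
  · congr 1
    field_simp

open Matrix in
lemma bilinNorm_le_of_conjTranspose_mul_self {𝕂 : Type*} [RCLike 𝕂] {p q : ℝ} (hp : 2 ≤ p)
    (hq : 2 ≤ q) {n : ℕ} (hn : 0 < n) {H : Matrix (Fin n) (Fin n) 𝕂}
    (hH : Hᴴ * H = (n : 𝕂) • 1) :
    bilinNorm 𝕂 p q (Matrix.toLinearMap₂' 𝕂 H.transpose) ≤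
      (n : ℝ) ^ (3 / 2 - 1 / p - 1 / q) := by
  have hn' : (0 : ℝ) < n := by exact_mod_cast hn
  refine Real.sSup_le ?_ (by positivity)
  rintro t ⟨x, y, hx, hy, rfl⟩
  refine le_of_pow_le_pow_left₀ two_ne_zero (by positivity) ?_
  have hA : Matrix.toLinearMap₂' 𝕂 H.transpose x y = ∑ k, (H *ᵥ x) k * y k := by
    rw [Matrix.toLinearMap₂'_apply', dotProduct_mulVec, vecMul_transpose]
    rfl
  calc ‖Matrix.toLinearMap₂' 𝕂 H.transpose x y‖ ^ 2
      ≤ (∑ k, ‖(H *ᵥ x) k‖ * ‖y k‖) ^ 2 := by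
        rw [hA]
        gcongr
        exact (norm_sum_le _ _).trans_eq (by simp only [norm_mul])
    _ ≤ (∑ k, ‖(H *ᵥ x) k‖ ^ 2) * ∑ k, ‖y k‖ ^ 2 :=
        Finset.sum_mul_sq_le_sq_mul_sq _ _ _
    _ = n * (∑ k, ‖x k‖ ^ 2) * ∑ k, ‖y k‖ ^ 2 := by
        rw [sum_norm_sq_mulVec_of_conjTranspose_mul_self (c := n) (by rwa [RCLike.ofReal_natCast])]
    _ ≤ n * (n : ℝ) ^ (1 - 2 / p) * (n : ℝ) ^ (1 - 2 / q) := by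
        gcongr
        · exact sum_norm_sq_le_of_lpNorm_le_one hp hx
        · exact sum_norm_sq_le_of_lpNorm_le_one hq hy
    _ = ((n : ℝ) ^ (3 / 2 - 1 / p - 1 / q)) ^ 2 := by
        rw [← Real.rpow_natCast, ← Real.rpow_mul hn'.le, ← Real.rpow_one_add' hn'.le,
          ← Real.rpow_add hn']
        · congr 1
          push_cast
          ring
        · have : 2 / p ≤ 1 := (div_le_one (by linarith)).2 hp
          linarith

theorem hardy_littlewood_revisited_inner_exponent_optimal
    (𝕂 : Type*) [RCLike 𝕂] (p q : ℝ) (hp : 2 ≤ p) (hq : 2 ≤ q)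
    (hpq : 1 / p + 1 / q < 1) (lam : ℝ) (hlam : lam = p * q / (p * q - p - q))
    (r C : ℝ) (hr : 0 < r) (hC : 0 < C)
    (h : ∀ n : ℕ, 0 < n → ∀ A : (Fin n → 𝕂) →ₗ[𝕂] (Fin n → 𝕂) →ₗ[𝕂] 𝕂,
      (∑ k : Fin n, (∑ j : Fin n,
          ‖A (Pi.single j (1 : 𝕂)) (Pi.single k (1 : 𝕂))‖ ^ r) ^ (lam / r)) ^ (1 / lam)
        ≤ C * bilinNorm 𝕂 p q A) :
    2 ≤ r := by
  have hp0 : 0 < p := by linarith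
  have hq0 : 0 < q := by linarith
  have hden : 0 < p * q - p - q := by
    have := mul_lt_mul_of_pos_right hpq (mul_pos hp0 hq0)
    field_simp at this
    linarith
  have hlam0 : 0 < lam := by rw [hlam]; positivity
  have hlam_inv : 1 / lam = 1 - 1 / p - 1 / q := by
    rw [hlam]
    field_simp
    ring
  by_contra! hr2
  have hgap : 0 < 1 / r - 1 / 2 := sub_pos.2 (one_div_lt_one_div_of_lt hr hr2)
  obtain ⟨m, hm⟩ := pow_unbounded_of_one_lt C
    (Real.one_lt_rpow (x := 2) (by norm_num) hgap)
  obtain ⟨H, hnorm, hH⟩ := exists_hadamard_two_pow 𝕂 m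
  have hpow : ((2 : ℝ) ^ (1 / r - 1 / 2)) ^ m = ((2 ^ m : ℕ) : ℝ) ^ (1 / r - 1 / 2) := by
    push_cast
    rw [Real.rpow_pow_comm (by norm_num)]
  rw [hpow] at hm
  generalize hN : 2 ^ m = n at H hnorm hH hm
  have hn : 0 < n := by rw [← hN]; positivity
  have hn' : (0 : ℝ) < n := by exact_mod_cast hn
  have hle := h n hn (Matrix.toLinearMap₂' 𝕂 H.transpose)
  have hentry (j k : Fin n) : ‖Matrix.toLinearMap₂' 𝕂 H.transpose (Pi.single j (1 : 𝕂))
      (Pi.single k (1 : 𝕂))‖ = 1 := by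
    simp [Matrix.toLinearMap₂'_apply', hnorm]
  simp only [hentry, Real.one_rpow, Finset.sum_const, Finset.card_univ, Fintype.card_fin,
    nsmul_eq_mul, mul_one] at hle
  have hlhs : ((n : ℝ) * (n : ℝ) ^ (lam / r)) ^ (1 / lam) =
      (n : ℝ) ^ (1 / r - 1 / 2) * (n : ℝ) ^ (3 / 2 - 1 / p - 1 / q) := by
    rw [← Real.rpow_one_add' hn'.le (by positivity), ← Real.rpow_mul hn'.le,
      ← Real.rpow_add hn']
    congr 1
    have : (1 + lam / r) * (1 / lam) = 1 / lam + 1 / r := by field_simp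
    rw [this, hlam_inv]
    ring
  rw [hlhs] at hle
  have hbound := hle.trans
    (mul_le_mul_of_nonneg_left (bilinNorm_le_of_conjTranspose_mul_self hp hq hn hH) hC.le)
  exact hm.not_ge (le_of_mul_le_mul_right hbound (by positivity))
end
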